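/- Let w be an A₂ weight on ℝ^d. Then for every dyadic cube I ∈ 𝒟 and every α ∈ Γ_d, ∑_{J⊆I} ∑_{β: E_{β,J} ⊆ E_{α,I}} |ŵ^{-1}(J,β)|² / ⟨w^{-1}⟩²_{E_{β,J}} ≤ C_d · [w]_{A₂} · |E_{α,I}|, where ŵ^{-1}(J,β) = ⟨w^{-1}, h_J^β⟩_{L²}, the sum is over dyadic cubes J ⊆ I and β ∈ Γ_d with E_{β,J} ⊆ E_{α,I}, and C_d depends only on the dimension d. -/

import Mathlib

open MeasureTheory

noncomputable section

/-- A dyadic cube in `ℝ^d`: the cube `∏ᵢ [mᵢ 2^k, (mᵢ+1) 2^k)`. -/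
structure DyadicCube (d : ℕ) where
  k : ℤ
  m : Fin d → ℤ
deriving DecidableEq

namespace DyadicCube

/-- The underlying set of a dyadic cube. -/
def toSet {d : ℕ} (I : DyadicCube d) : Set (Fin d → ℝ) :=
  {x | ∀ i, (I.m i : ℝ) * (2 : ℝ) ^ I.k ≤ x i ∧ x i < ((I.m i : ℝ) + 1) * (2 : ℝ) ^ I.k}

/-- `J` is a dyadic child of `I`. -/
def IsChild {d : ℕ} (J I : DyadicCube d) : Prop :=
  J.k + 1 = I.k ∧ J.toSet ⊆ I.toSet

end DyadicCube

/-- The index set `Γ_d = {0,1}^d \ {(1,…,1)}`. -/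
def Gamma (d : ℕ) : Type := {v : Fin d → Bool // v ≠ fun _ => true}

instance {d : ℕ} : DecidableEq (Gamma d) := Subtype.instDecidableEq

/-- The average `⟨f⟩_E` of `f` over a set `E`. -/
def avg {d : ℕ} (E : Set (Fin d → ℝ)) (f : (Fin d → ℝ) → ℝ) : ℝ :=
  (∫ x in E, f x) / (volume E).toReal

/-- An axis-parallel cube with corner `c` and side length `r`. -/
def Cube {d : ℕ} (c : Fin d → ℝ) (r : ℝ) : Set (Fin d → ℝ) :=
  {x | ∀ i, c i ≤ x i ∧ x i < c i + r}

/-- `A` is an upper bound for the `A₂` characteristic of `w`: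
`⟨w⟩_I ⟨w⁻¹⟩_I ≤ A` for every cube `I`. -/
def IsA2Bound {d : ℕ} (w : (Fin d → ℝ) → ℝ) (A : ℝ) : Prop :=
  ∀ (c : Fin d → ℝ) (r : ℝ), 0 < r →
    avg (Cube c r) w * avg (Cube c r) (fun x => (w x)⁻¹) ≤ A

/-- A weight: a positive, measurable, locally integrable function (with locally
integrable reciprocal). -/
def IsWeight {d : ℕ} (w : (Fin d → ℝ) → ℝ) : Prop :=
  (∀ x, 0 < w x) ∧ Measurable w ∧ LocallyIntegrable w volume ∧
    LocallyIntegrable (fun x => (w x)⁻¹) volume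

/-- The `L¹`-normalized indicator `h¹_E = 1_E / |E|`. -/
def h1 {d : ℕ} (E : Set (Fin d → ℝ)) : (Fin d → ℝ) → ℝ :=
  fun x => ((volume E).toReal)⁻¹ * E.indicator (fun _ => (1 : ℝ)) x

/-- Wilson's system of pairs of sets `(E¹_{α,I}, E²_{α,I})` indexed by dyadic cubes
`I` and `α ∈ Γ_d`. -/
structure WilsonSystem (d : ℕ) where
  E1 : DyadicCube d → Gamma d → Set (Fin d → ℝ)
  E2 : DyadicCube d → Gamma d → Set (Fin d → ℝ)
  childUnion1 : ∀ I α, ∃ S : Finset (DyadicCube d), S.Nonempty ∧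
    (∀ J ∈ S, J.IsChild I) ∧ E1 I α = ⋃ J ∈ S, J.toSet
  childUnion2 : ∀ I α, ∃ S : Finset (DyadicCube d), S.Nonempty ∧
    (∀ J ∈ S, J.IsChild I) ∧ E2 I α = ⋃ J ∈ S, J.toSet
  measEq : ∀ I α, volume (E1 I α) = volume (E2 I α)
  disj : ∀ I α, Disjoint (E1 I α) (E2 I α)
  nestedOrDisjoint : ∀ I α J β, (I, α) ≠ (J, β) →
    (E1 I α ∪ E2 I α) ⊆ E1 J β ∨ (E1 I α ∪ E2 I α) ⊆ E2 J β ∨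
    (E1 J β ∪ E2 J β) ⊆ E1 I α ∨ (E1 J β ∪ E2 J β) ⊆ E2 I α ∨
    Disjoint (E1 I α ∪ E2 I α) (E1 J β ∪ E2 J β)

namespace WilsonSystem

variable {d : ℕ}

/-- `E_{α,I} = E¹_{α,I} ∪ E²_{α,I}`. -/
def E (W : WilsonSystem d) (I : DyadicCube d) (α : Gamma d) : Set (Fin d → ℝ) :=
  W.E1 I α ∪ W.E2 I α

/-- The Wilson Haar function `h_I^α = |E_{α,I}|^{-1/2} (1_{E²_{α,I}} - 1_{E¹_{α,I}})`. -/
def haar (W : WilsonSystem d) (I : DyadicCube d) (α : Gamma d) : (Fin d → ℝ) → ℝ :=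
  fun x => (Real.sqrt (volume (W.E I α)).toReal)⁻¹ *
    ((W.E2 I α).indicator (fun _ => (1 : ℝ)) x - (W.E1 I α).indicator (fun _ => (1 : ℝ)) x)

/-- The Haar coefficient `f̂(I,α) = ⟨f, h_I^α⟩_{L²}`. -/
def hcoef (W : WilsonSystem d) (f : (Fin d → ℝ) → ℝ) (I : DyadicCube d) (α : Gamma d) : ℝ :=
  ∫ x, f x * W.haar I α x

/-- The weighted Wilson Haar function `h_I^{w,α}`. -/
def haarW (W : WilsonSystem d) (w : (Fin d → ℝ) → ℝ) (I : DyadicCube d) (α : Gamma d) :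
    (Fin d → ℝ) → ℝ :=
  fun x => (Real.sqrt (∫ y in W.E I α, w y))⁻¹ *
    (Real.sqrt ((∫ y in W.E1 I α, w y) / (∫ y in W.E2 I α, w y)) *
        (W.E2 I α).indicator (fun _ => (1 : ℝ)) x -
      Real.sqrt ((∫ y in W.E2 I α, w y) / (∫ y in W.E1 I α, w y)) *
        (W.E1 I α).indicator (fun _ => (1 : ℝ)) x)

/-- The Haar multiplier `T_σ f = ∑_{I,α} σ_{I,α} f̂(I,α) h_I^α`. -/
def Tmult (W : WilsonSystem d) (σ : DyadicCube d → Gamma d → ℝ) (f : (Fin d → ℝ) → ℝ) :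
    (Fin d → ℝ) → ℝ :=
  fun x => ∑' p : DyadicCube d × Gamma d, σ p.1 p.2 * W.hcoef f p.1 p.2 * W.haar p.1 p.2 x

/-- The paraproduct `P_a^{(0,0)} f = ∑_{I,α} a_{I,α} f̂(I,α) h_I^α`. -/
def P00 (W : WilsonSystem d) (a : DyadicCube d → Gamma d → ℝ) (f : (Fin d → ℝ) → ℝ) :
    (Fin d → ℝ) → ℝ :=
  fun x => ∑' p : DyadicCube d × Gamma d, a p.1 p.2 * W.hcoef f p.1 p.2 * W.haar p.1 p.2 x

/-- The paraproduct `P_a^{(0,1)} f = ∑_{I,α} a_{I,α} ⟨f⟩_{E_{α,I}} h_I^α`. -/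
def P01 (W : WilsonSystem d) (a : DyadicCube d → Gamma d → ℝ) (f : (Fin d → ℝ) → ℝ) :
    (Fin d → ℝ) → ℝ :=
  fun x => ∑' p : DyadicCube d × Gamma d, a p.1 p.2 * avg (W.E p.1 p.2) f * W.haar p.1 p.2 x

/-- The paraproduct `P_a^{(1,0)} f = ∑_{I,α} a_{I,α} f̂(I,α) h¹_{E_{α,I}}`. -/
def P10 (W : WilsonSystem d) (a : DyadicCube d → Gamma d → ℝ) (f : (Fin d → ℝ) → ℝ) :
    (Fin d → ℝ) → ℝ :=
  fun x => ∑' p : DyadicCube d × Gamma d, a p.1 p.2 * W.hcoef f p.1 p.2 * h1 (W.E p.1 p.2) x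

/-- The dyadic square function
`S f(x) = (∑_{I,α} |f̂(I,α)|² 1_I(x)/|I|)^{1/2}`. -/
def sqFn (W : WilsonSystem d) (f : (Fin d → ℝ) → ℝ) : (Fin d → ℝ) → ℝ :=
  fun x => Real.sqrt (∑' p : DyadicCube d × Gamma d,
    (W.hcoef f p.1 p.2) ^ 2 * p.1.toSet.indicator (fun _ => (1 : ℝ)) x /
      (volume p.1.toSet).toReal)

/-- The canonical paraproduct of type `ε` built from the function `g`:
`ε = 0` gives `P^{(0,1)}_{ĝ}`, `ε = 1` gives `P^{(1,0)}_{ĝ}`, and `ε = 2` gives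
`P^{(0,0)}_{⟨g⟩}`. -/
def paraOf (W : WilsonSystem d) (g : (Fin d → ℝ) → ℝ) (ε : Fin 3) :
    ((Fin d → ℝ) → ℝ) → ((Fin d → ℝ) → ℝ) :=
  if ε = 0 then W.P01 (fun I α => W.hcoef g I α)
  else if ε = 1 then W.P10 (fun I α => W.hcoef g I α)
  else W.P00 (fun I α => avg (W.E I α) g)

end WilsonSystem

/-- The weighted measure `w(x) dx` on `ℝ^d`. -/
def wMeasure {d : ℕ} (w : (Fin d → ℝ) → ℝ) : Measure (Fin d → ℝ) :=
  volume.withDensity fun x => ENNReal.ofReal (w x)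


/-- `s log (V/s)`. -/
def entL (s V : ℝ) : ℝ := s * Real.log (V / s)

lemma entL_zero (V : ℝ) : entL 0 V = 0 := by simp [entL]

lemma entL_mono {s V V' : ℝ} (hs : 0 ≤ s) (hV : 0 < s → 0 < V) (h : V ≤ V') :
    entL s V ≤ entL s V' := by
  rcases hs.eq_or_lt with h0 | h0
  · rw [← h0]; simp [entL]
  · have := hV h0
    unfold entL
    gcongr

lemma entL_superadd {s₁ s₂ V₁ V₂ : ℝ} (h₁ : 0 ≤ s₁) (h₂ : 0 ≤ s₂) (hV₁ : 0 ≤ V₁) (hV₂ : 0 ≤ V₂)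
    (p₁ : 0 < s₁ → 0 < V₁) (p₂ : 0 < s₂ → 0 < V₂) :
    entL s₁ V₁ + entL s₂ V₂ ≤ entL (s₁ + s₂) (V₁ + V₂) := by
  rcases h₁.eq_or_lt with h | h
  · rw [← h, entL_zero, zero_add, zero_add]
    exact entL_mono h₂ p₂ (by linarith)
  rcases h₂.eq_or_lt with h' | h'
  · rw [← h', entL_zero, add_zero, add_zero]
    exact entL_mono h₁ p₁ (by linarith)
  have q₁ := p₁ h
  have q₂ := p₂ h'
  have key : ∀ s V : ℝ, 0 < s → 0 < V →
      entL s V ≤ s * Real.log ((V₁ + V₂) / (s₁ + s₂)) + (V * (s₁ + s₂) / (V₁ + V₂) - s) := by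
    intro s V hs hV
    have e : Real.log (V / s) = Real.log ((V₁ + V₂) / (s₁ + s₂)) +
        Real.log (V * (s₁ + s₂) / (s * (V₁ + V₂))) := by
      rw [← Real.log_mul (by positivity) (by positivity)]
      congr 1
      field_simp
    have l := Real.log_le_sub_one_of_pos (x := V * (s₁ + s₂) / (s * (V₁ + V₂))) (by positivity)
    have l2 := mul_le_mul_of_nonneg_left l hs.le
    have e2 : s * (V * (s₁ + s₂) / (s * (V₁ + V₂)) - 1) = V * (s₁ + s₂) / (V₁ + V₂) - s := by
      field_simp
    unfold entL
    rw [e, mul_add]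
    linarith
  have k₁ := key s₁ V₁ h q₁
  have k₂ := key s₂ V₂ h' q₂
  have e : V₁ * (s₁ + s₂) / (V₁ + V₂) + V₂ * (s₁ + s₂) / (V₁ + V₂) = s₁ + s₂ := by
    field_simp
  have e3 : entL (s₁ + s₂) (V₁ + V₂) = s₁ * Real.log ((V₁ + V₂) / (s₁ + s₂)) +
    s₂ * Real.log ((V₁ + V₂) / (s₁ + s₂)) := by unfold entL; ring
  linarith

lemma entL_gain {s a b : ℝ} (hs : 0 < s) (ha : 0 < a) (hb : 0 < b) :
    entL s a + entL s b + s * ((a - b) / (a + b)) ^ 2 ≤ entL (s + s) (a + b) := by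
  have l := Real.log_le_sub_one_of_pos (x := 4 * a * b / (a + b) ^ 2) (by positivity)
  have e : Real.log (4 * a * b / (a + b) ^ 2) =
      Real.log (a / s) + Real.log (b / s) - 2 * Real.log ((a + b) / (s + s)) := by
    have e2 : 2 * Real.log ((a + b) / (s + s)) = Real.log (((a + b) / (s + s)) ^ 2) := by
      rw [Real.log_pow]; norm_num
    rw [e2, ← Real.log_mul (by positivity) (by positivity),
      ← Real.log_div (by positivity) (by positivity)]
    congr 1
    field_simp
    ring
  have e3 : 4 * a * b / (a + b) ^ 2 - 1 = - ((a - b) / (a + b)) ^ 2 := by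
    field_simp
    ring
  rw [e, e3] at l
  have := mul_le_mul_of_nonneg_left l hs.le
  unfold entL
  linarith

section meas
variable {X : Type*} [MeasurableSpace X] {μ : Measure X}

/-- The Bellman functional. -/
def phi (μ : Measure X) (v w : X → ℝ) (S : Set X) : ℝ :=
  entL (μ.real S) (∫ x in S, v x ∂μ) + entL (μ.real S) (∫ x in S, w x ∂μ)

lemma int_pos {v : X → ℝ} (hv : ∀ x, 0 < v x) {S : Set X}
    (hi : IntegrableOn v S μ) (h : 0 < μ.real S) : 0 < ∫ x in S, v x ∂μ := by
  rw [setIntegral_pos_iff_support_of_nonneg_ae (Filter.Eventually.of_forall fun x => (hv x).le) hi]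
  have : Function.support v = Set.univ := by
    ext x; simp [(hv x).ne']
  rw [this, Set.univ_inter]
  exact (ENNReal.toReal_pos_iff.1 h).1

lemma phi_nonneg {v w : X → ℝ} (hv : ∀ x, 0 < v x) (hw : ∀ x, 0 < w x) (hvw : ∀ x, v x * w x = 1)
    {S : Set X} (hiv : IntegrableOn v S μ) (hiw : IntegrableOn w S μ) (hf : μ S ≠ ⊤) :
    0 ≤ phi μ v w S := by
  rcases (measureReal_nonneg (μ := μ) (s := S)).eq_or_lt with h | h
  · simp [phi, ← h, entL_zero]
  have pv := int_pos hv hiv h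
  have pw := int_pos hw hiw h
  set s := μ.real S with hs
  set V := ∫ x in S, v x ∂μ with hV
  set U := ∫ x in S, w x ∂μ with hU
  have hc : ∫ x in S, (2 : ℝ) ∂μ ≤ ∫ x in S, ((s / V) * v x + (V / s) * w x) ∂μ := by
    apply integral_mono
    · exact integrableOn_const hf
    · exact (hiv.const_mul _).add (hiw.const_mul _)
    · intro x
      have h1 : (s / V * v x) * (V / s * w x) = 1 := by
        have : (s / V * v x) * (V / s * w x) = (s / V * (V / s)) * (v x * w x) := by ring
        rw [this, hvw]; field_simp
      have h2 : 0 < s / V * v x := mul_pos (by positivity) (hv x)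
      have h3 : 0 < V / s * w x := mul_pos (by positivity) (hw x)
      show (2:ℝ) ≤ s / V * v x + V / s * w x
      nlinarith [sq_nonneg (s / V * v x - V / s * w x)]
  rw [integral_add (hiv.const_mul _) (hiw.const_mul _), integral_const_mul, integral_const_mul,
    setIntegral_const, ← hs, ← hV, ← hU, smul_eq_mul, div_mul_cancel₀ _ pv.ne'] at hc
  have h5 : 1 ≤ V / s * (U / s) := by
    have : s ≤ V / s * U := by linarith
    have h6 : V / s * (U / s) = (V / s * U) / s := by ring
    rw [h6, le_div_iff₀ h]; linarith
  unfold phi entL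
  rw [← hs, ← hV, ← hU, ← mul_add, ← Real.log_mul (by positivity) (by positivity)]
  exact mul_nonneg h.le (Real.log_nonneg h5)

lemma phi_superadd {v w : X → ℝ} (hv : ∀ x, 0 < v x) (hw : ∀ x, 0 < w x)
    {S T : Set X} (hT : MeasurableSet T) (hST : Disjoint S T)
    (hiv : IntegrableOn v (S ∪ T) μ) (hiw : IntegrableOn w (S ∪ T) μ) (hf : μ (S ∪ T) ≠ ⊤) :
    phi μ v w S + phi μ v w T ≤ phi μ v w (S ∪ T) := by
  have f1 : μ S ≠ ⊤ := ne_top_of_le_ne_top hf (measure_mono Set.subset_union_left)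
  have f2 : μ T ≠ ⊤ := ne_top_of_le_ne_top hf (measure_mono Set.subset_union_right)
  unfold phi
  rw [setIntegral_union hST hT hiv.left_of_union hiv.right_of_union,
    setIntegral_union hST hT hiw.left_of_union hiw.right_of_union,
    measureReal_union hST hT f1 f2]
  have a := entL_superadd (measureReal_nonneg (μ := μ) (s := S))
    (measureReal_nonneg (μ := μ) (s := T))
    (integral_nonneg fun x => (hv x).le) (integral_nonneg fun x => (hv x).le)
    (int_pos hv hiv.left_of_union) (int_pos hv hiv.right_of_union)
  have b := entL_superadd (measureReal_nonneg (μ := μ) (s := S))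
    (measureReal_nonneg (μ := μ) (s := T))
    (integral_nonneg fun x => (hw x).le) (integral_nonneg fun x => (hw x).le)
    (int_pos hw hiw.left_of_union) (int_pos hw hiw.right_of_union)
  linarith

/-- The Carleson coefficient. -/
def coefC (μ : Measure X) (v : X → ℝ) (S T : Set X) : ℝ :=
  μ.real S * (((∫ x in S, v x ∂μ) - ∫ x in T, v x ∂μ) /
    ((∫ x in S, v x ∂μ) + ∫ x in T, v x ∂μ)) ^ 2

lemma phi_gain {v w : X → ℝ} (hv : ∀ x, 0 < v x) (hw : ∀ x, 0 < w x)
    {S T : Set X} (hT : MeasurableSet T) (hST : Disjoint S T)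
    (hpos : 0 < μ.real S) (heq : μ.real S = μ.real T)
    (hiv : IntegrableOn v (S ∪ T) μ) (hiw : IntegrableOn w (S ∪ T) μ) (hf : μ (S ∪ T) ≠ ⊤) :
    phi μ v w S + phi μ v w T + coefC μ v S T ≤ phi μ v w (S ∪ T) := by
  have f1 : μ S ≠ ⊤ := ne_top_of_le_ne_top hf (measure_mono Set.subset_union_left)
  have f2 : μ T ≠ ⊤ := ne_top_of_le_ne_top hf (measure_mono Set.subset_union_right)
  unfold phi coefC
  rw [setIntegral_union hST hT hiv.left_of_union hiv.right_of_union,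
    setIntegral_union hST hT hiw.left_of_union hiw.right_of_union,
    measureReal_union hST hT f1 f2]
  have b := entL_superadd (measureReal_nonneg (μ := μ) (s := S))
    (measureReal_nonneg (μ := μ) (s := T))
    (integral_nonneg fun x => (hw x).le) (integral_nonneg fun x => (hw x).le)
    (int_pos hw hiw.left_of_union) (int_pos hw hiw.right_of_union)
  have a := entL_gain hpos (int_pos hv hiv.left_of_union hpos)
    (int_pos hv hiv.right_of_union (heq ▸ hpos))
  rw [← heq] at b ⊢
  linarith

lemma carleson_abstract {ι : Type*} [DecidableEq ι] {v w : X → ℝ}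
    (hv : ∀ x, 0 < v x) (hw : ∀ x, 0 < w x) (hvw : ∀ x, v x * w x = 1)
    (E₁ E₂ : ι → Set X) (m₁ : ∀ i, MeasurableSet (E₁ i)) (m₂ : ∀ i, MeasurableSet (E₂ i))
    (hd : ∀ i, Disjoint (E₁ i) (E₂ i)) (hpos : ∀ i, 0 < μ.real (E₁ i))
    (heq : ∀ i, μ.real (E₁ i) = μ.real (E₂ i))
    (hn : ∀ i j, i ≠ j → E₁ i ∪ E₂ i ⊆ E₁ j ∨ E₁ i ∪ E₂ i ⊆ E₂ j ∨
      E₁ j ∪ E₂ j ⊆ E₁ i ∨ E₁ j ∪ E₂ j ⊆ E₂ i ∨ Disjoint (E₁ i ∪ E₂ i) (E₁ j ∪ E₂ j))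
    (n : ℕ) : ∀ (F : Finset ι) (S : Set X), F.card ≤ n → MeasurableSet S →
      IntegrableOn v S μ → IntegrableOn w S μ → μ S ≠ ⊤ → (∀ i ∈ F, E₁ i ∪ E₂ i ⊆ S) →
      ∑ i ∈ F, coefC μ v (E₁ i) (E₂ i) ≤ phi μ v w S := by
  induction n with
  | zero =>
    intro F S hF hS hiv hiw hf hsub
    have : F = ∅ := by simpa using hF
    rw [this, Finset.sum_empty]
    exact phi_nonneg hv hw hvw hiv hiw hf
  | succ n ih =>
    intro F S hF hS hiv hiw hf hsub
    rcases F.eq_empty_or_nonempty with h0 | hne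
    · rw [h0, Finset.sum_empty]
      exact phi_nonneg hv hw hvw hiv hiw hf
    obtain ⟨p, hp, hmax⟩ := F.exists_max_image (fun i => μ.real (E₁ i)) hne
    have hEp := hsub p hp
    have hE1 : E₁ p ⊆ S := Set.subset_union_left.trans hEp
    have hE2 : E₂ p ⊆ S := Set.subset_union_right.trans hEp
    have fin : ∀ T ⊆ S, μ T ≠ ⊤ := fun T hT => ne_top_of_le_ne_top hf (measure_mono hT)
    -- classification
    have cls : ∀ q ∈ F.erase p, E₁ q ∪ E₂ q ⊆ E₁ p ∨ E₁ q ∪ E₂ q ⊆ E₂ p ∨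
        E₁ q ∪ E₂ q ⊆ S \ (E₁ p ∪ E₂ p) := by
      intro q hq
      have hqF := Finset.mem_of_mem_erase hq
      have hqS := hsub q hqF
      have mp := hmax q hqF
      have hu : μ.real (E₁ p ∪ E₂ p) = μ.real (E₁ p) + μ.real (E₁ p) := by
        rw [measureReal_union (hd p) (m₂ p) (fin _ hE1) (fin _ hE2), heq p]
      rcases hn q p (Finset.ne_of_mem_erase hq) with h | h | h | h | h
      · exact Or.inl h
      · exact Or.inr (Or.inl h)
      · have := measureReal_mono (μ := μ) h (fin _ (Set.subset_union_left.trans hqS))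
        have := hpos p
        linarith
      · have := measureReal_mono (μ := μ) h (fin _ (Set.subset_union_right.trans hqS))
        have := hpos p
        have := heq q
        linarith
      · exact Or.inr (Or.inr (Set.subset_sdiff.2 ⟨hqS, h⟩))
    classical
    set F1 := (F.erase p).filter (fun q => E₁ q ∪ E₂ q ⊆ E₁ p)
    set G := (F.erase p).filter (fun q => ¬ E₁ q ∪ E₂ q ⊆ E₁ p)
    set F2 := G.filter (fun q => E₁ q ∪ E₂ q ⊆ E₂ p)
    set F3 := G.filter (fun q => ¬ E₁ q ∪ E₂ q ⊆ E₂ p)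
    have card : (F.erase p).card ≤ n := by
      rw [Finset.card_erase_of_mem hp]; omega
    have s1 : F1 ⊆ F.erase p := Finset.filter_subset _ _
    have s2 : F2 ⊆ F.erase p := (Finset.filter_subset _ _).trans (Finset.filter_subset _ _)
    have s3 : F3 ⊆ F.erase p := (Finset.filter_subset _ _).trans (Finset.filter_subset _ _)
    have i1 := ih F1 (E₁ p) ((Finset.card_le_card s1).trans card) (m₁ p) (hiv.mono_set hE1)
      (hiw.mono_set hE1) (fin _ hE1) (fun i hi => (Finset.mem_filter.1 hi).2)
    have i2 := ih F2 (E₂ p) ((Finset.card_le_card s2).trans card) (m₂ p) (hiv.mono_set hE2)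
      (hiw.mono_set hE2) (fin _ hE2) (fun i hi => (Finset.mem_filter.1 hi).2)
    have hD : S \ (E₁ p ∪ E₂ p) ⊆ S := Set.sdiff_subset
    have i3 := ih F3 (S \ (E₁ p ∪ E₂ p)) ((Finset.card_le_card s3).trans card)
      (hS.diff ((m₁ p).union (m₂ p))) (hiv.mono_set hD)
      (hiw.mono_set hD) (fin _ hD) (fun i hi => by
        have h3 := Finset.mem_filter.1 hi
        have h2 := Finset.mem_filter.1 h3.1
        rcases cls i h2.1 with h | h | h
        · exact absurd h h2.2
        · exact absurd h h3.2
        · exact h)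
    have e1 : ∑ i ∈ F1, coefC μ v (E₁ i) (E₂ i) + ∑ i ∈ G, coefC μ v (E₁ i) (E₂ i) =
      ∑ i ∈ F.erase p, coefC μ v (E₁ i) (E₂ i) := Finset.sum_filter_add_sum_filter_not _ _ _
    have e2 : ∑ i ∈ F2, coefC μ v (E₁ i) (E₂ i) + ∑ i ∈ F3, coefC μ v (E₁ i) (E₂ i) =
      ∑ i ∈ G, coefC μ v (E₁ i) (E₂ i) := Finset.sum_filter_add_sum_filter_not _ _ _
    have e3 := Finset.sum_erase_add F (fun i => coefC μ v (E₁ i) (E₂ i)) hp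
    have g := phi_gain hv hw (m₂ p) (hd p) (hpos p) (heq p) (hiv.mono_set hEp) (hiw.mono_set hEp)
      (fin _ hEp)
    have eS : S \ (E₁ p ∪ E₂ p) ∪ (E₁ p ∪ E₂ p) = S := Set.sdiff_union_of_subset hEp
    have g2 := phi_superadd (μ := μ) hv hw ((m₁ p).union (m₂ p))
      (Set.disjoint_sdiff_left (s := E₁ p ∪ E₂ p) (t := S))
      (by rwa [eS]) (by rwa [eS]) (by rwa [eS])
    rw [eS] at g2
    linarith

end meas

lemma DyadicCube.toSet_eq_pi {d : ℕ} (I : DyadicCube d) : I.toSet =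
    Set.univ.pi fun i => Set.Ico ((I.m i : ℝ) * (2 : ℝ) ^ I.k) (((I.m i : ℝ) + 1) * (2 : ℝ) ^ I.k) := by
  ext x; simp [DyadicCube.toSet, Set.mem_pi]

lemma DyadicCube.measurableSet {d : ℕ} (I : DyadicCube d) : MeasurableSet I.toSet := by
  rw [I.toSet_eq_pi]
  exact MeasurableSet.univ_pi fun i => measurableSet_Ico

lemma DyadicCube.volume_eq {d : ℕ} (I : DyadicCube d) :
    volume I.toSet = ENNReal.ofReal (((2 : ℝ) ^ I.k) ^ d) := by
  rw [I.toSet_eq_pi, Real.volume_pi_Ico]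
  have : ∀ i, ((I.m i : ℝ) + 1) * (2 : ℝ) ^ I.k - (I.m i : ℝ) * (2 : ℝ) ^ I.k = (2 : ℝ) ^ I.k := by
    intro i; ring
  simp only [this, Finset.prod_const, Finset.card_univ, Fintype.card_fin]
  rw [ENNReal.ofReal_pow (by positivity)]

lemma DyadicCube.real_eq {d : ℕ} (I : DyadicCube d) :
    volume.real I.toSet = ((2 : ℝ) ^ I.k) ^ d := by
  rw [measureReal_def, I.volume_eq, ENNReal.toReal_ofReal (by positivity)]

lemma DyadicCube.ne_top {d : ℕ} (I : DyadicCube d) : volume I.toSet ≠ ⊤ := by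
  rw [I.volume_eq]; exact ENNReal.ofReal_ne_top

lemma DyadicCube.eq_cube {d : ℕ} (I : DyadicCube d) :
    I.toSet = Cube (fun i => (I.m i : ℝ) * (2 : ℝ) ^ I.k) ((2 : ℝ) ^ I.k) := by
  ext x; simp [DyadicCube.toSet, Cube, add_mul]

lemma DyadicCube.integrableOn {d : ℕ} (I : DyadicCube d) {f : (Fin d → ℝ) → ℝ}
    (hf : LocallyIntegrable f volume) : IntegrableOn f I.toSet volume := by
  have := hf.integrableOn_isCompact (isCompact_Icc (a := fun i => (I.m i : ℝ) * (2 : ℝ) ^ I.k)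
    (b := fun i => ((I.m i : ℝ) + 1) * (2 : ℝ) ^ I.k))
  apply this.mono_set
  intro x hx
  exact ⟨fun i => (hx i).1, fun i => (hx i).2.le⟩

lemma union_facts {d : ℕ} (I : DyadicCube d) (E : Set (Fin d → ℝ))
    (h : ∃ S : Finset (DyadicCube d), S.Nonempty ∧
    (∀ J ∈ S, J.IsChild I) ∧ E = ⋃ J ∈ S, J.toSet) :
    MeasurableSet E ∧ E ⊆ I.toSet ∧ volume.real I.toSet ≤ 2 ^ d * volume.real E := by
  obtain ⟨S, ⟨J, hJ⟩, hc, rfl⟩ := h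
  have hsub : (⋃ J ∈ S, J.toSet) ⊆ I.toSet := Set.iUnion₂_subset fun J hJ => (hc J hJ).2
  refine ⟨S.measurableSet_biUnion fun J _ => J.measurableSet, hsub, ?_⟩
  have h1 : volume.real J.toSet ≤ volume.real (⋃ J ∈ S, J.toSet) :=
    measureReal_mono (Set.subset_biUnion_of_mem (u := fun J : DyadicCube d => J.toSet) hJ)
      (ne_top_of_le_ne_top I.ne_top (measure_mono hsub))
  have h2 : volume.real I.toSet = 2 ^ d * volume.real J.toSet := by
    rw [I.real_eq, J.real_eq, ← (hc J hJ).1, zpow_add₀ (by norm_num), zpow_one, mul_pow]; ring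
  rw [h2]; gcongr

lemma hcoef_eq {d : ℕ} (W : WilsonSystem d) {v : (Fin d → ℝ) → ℝ}
    (hi : LocallyIntegrable v volume) (J : DyadicCube d) (β : Gamma d) :
    W.hcoef v J β = (Real.sqrt (volume (W.E J β)).toReal)⁻¹ *
      ((∫ x in W.E2 J β, v x) - ∫ x in W.E1 J β, v x) := by
  obtain ⟨m1, s1, -⟩ := union_facts J _ (W.childUnion1 J β)
  obtain ⟨m2, s2, -⟩ := union_facts J _ (W.childUnion2 J β)
  have i1 := (J.integrableOn hi).mono_set s1
  have i2 := (J.integrableOn hi).mono_set s2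
  rw [← integral_indicator m1, ← integral_indicator m2,
    ← integral_sub (i2.integrable_indicator m2) (i1.integrable_indicator m1),
    ← integral_const_mul]
  unfold WilsonSystem.hcoef WilsonSystem.haar
  congr 1
  ext x
  by_cases h1 : x ∈ W.E1 J β <;> by_cases h2 : x ∈ W.E2 J β <;> simp [h1, h2] <;> ring

/-- Carleson estimate:
`∑_{J⊆I, E_{β,J}⊆E_{α,I}} |ŵ^{-1}(J,β)|² / ⟨w⁻¹⟩²_{E_{β,J}} ≤ C_d [w]_{A₂} |E_{α,I}|`. -/
theorem carleson_estimate_winv_normalized (d : ℕ) :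
    ∃ C : ℝ, 0 < C ∧
      ∀ (W : WilsonSystem d) (w : (Fin d → ℝ) → ℝ) (A : ℝ),
        IsWeight w → IsA2Bound w A →
        ∀ (I : DyadicCube d) (α : Gamma d) (F : Finset (DyadicCube d × Gamma d)),
          (∀ p ∈ F, p.1.toSet ⊆ I.toSet ∧ W.E p.1 p.2 ⊆ W.E I α) →
          ∑ p ∈ F,
              (W.hcoef (fun x => (w x)⁻¹) p.1 p.2) ^ 2 /
                (avg (W.E p.1 p.2) fun x => (w x)⁻¹) ^ 2 ≤
            C * A * (volume (W.E I α)).toReal := by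
  refine ⟨4 * 4 ^ d, by positivity, ?_⟩
  intro W w A hw hA I α F hF
  obtain ⟨hpos, -, hlw, hlv⟩ := hw
  have hvpos : ∀ x, 0 < (w x)⁻¹ := fun x => inv_pos.2 (hpos x)
  have f1 := fun p : DyadicCube d × Gamma d => union_facts p.1 _ (W.childUnion1 p.1 p.2)
  have f2 := fun p : DyadicCube d × Gamma d => union_facts p.1 _ (W.childUnion2 p.1 p.2)
  have hIpos : ∀ J : DyadicCube d, 0 < volume.real J.toSet := fun J => by
    rw [J.real_eq]; positivity
  have E1pos : ∀ p : DyadicCube d × Gamma d, 0 < volume.real (W.E1 p.1 p.2) := by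
    intro p
    have h1 := (f1 p).2.2
    have h2 := hIpos p.1
    by_contra hc
    have h3 : volume.real (W.E1 p.1 p.2) = 0 := le_antisymm (not_lt.1 hc) measureReal_nonneg
    rw [h3] at h1; linarith
  have heq : ∀ p : DyadicCube d × Gamma d,
      volume.real (W.E1 p.1 p.2) = volume.real (W.E2 p.1 p.2) := by
    intro p; rw [measureReal_def, measureReal_def, W.measEq]
  have hEsub : ∀ p : DyadicCube d × Gamma d, W.E p.1 p.2 ⊆ p.1.toSet := fun p =>
    Set.union_subset (f1 p).2.1 (f2 p).2.1
  have fin : ∀ (J : DyadicCube d) T, T ⊆ J.toSet → volume T ≠ ⊤ := fun J T hT =>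
    ne_top_of_le_ne_top J.ne_top (measure_mono hT)
  have hEvol : ∀ p : DyadicCube d × Gamma d,
      volume.real (W.E p.1 p.2) = 2 * volume.real (W.E1 p.1 p.2) := by
    intro p
    rw [WilsonSystem.E, measureReal_union (W.disj _ _) (f2 p).1 (fin _ _ (f1 p).2.1)
      (fin _ _ (f2 p).2.1), ← heq p]; ring
  have main := carleson_abstract (μ := volume) hvpos hpos (fun x => inv_mul_cancel₀ (hpos x).ne')
    (fun p : DyadicCube d × Gamma d => W.E1 p.1 p.2) (fun p => W.E2 p.1 p.2)
    (fun p => (f1 p).1) (fun p => (f2 p).1) (fun p => W.disj p.1 p.2) E1pos heq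
    (fun p q hpq => W.nestedOrDisjoint p.1 p.2 q.1 q.2 hpq) F.card F (W.E I α) le_rfl
    ((f1 (I, α)).1.union (f2 (I, α)).1) ((I.integrableOn hlv).mono_set (hEsub (I, α)))
    ((I.integrableOn hlw).mono_set (hEsub (I, α))) (fin I _ (hEsub (I, α)))
    (fun p hp => (hF p hp).2)
  have term : ∀ p ∈ F, (W.hcoef (fun x => (w x)⁻¹) p.1 p.2) ^ 2 /
      (avg (W.E p.1 p.2) fun x => (w x)⁻¹) ^ 2 =
      2 * coefC volume (fun x => (w x)⁻¹) (W.E1 p.1 p.2) (W.E2 p.1 p.2) := by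
    intro p _
    have hv := hEvol p
    have hp1 := E1pos p
    have j1 := (p.1.integrableOn hlv).mono_set (f1 p).2.1
    have j2 := (p.1.integrableOn hlv).mono_set (f2 p).2.1
    have q1 := int_pos hvpos j1 hp1
    have q2 := int_pos hvpos j2 (heq p ▸ hp1)
    rw [hcoef_eq W hlv, avg, ← measureReal_def, hv, coefC, mul_pow, inv_pow,
      Real.sq_sqrt (by positivity), WilsonSystem.E, setIntegral_union (W.disj _ _) (f2 p).1 j1 j2]
    field_simp
    ring
  rw [Finset.sum_congr rfl term, ← Finset.mul_sum]
  rw [← measureReal_def]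
  have hE0 : 0 < volume.real (W.E I α) := by
    have := hEvol (I, α); have := E1pos (I, α); simp only at *; linarith
  have jv := (I.integrableOn hlv).mono_set (hEsub (I, α))
  have jw := (I.integrableOn hlw).mono_set (hEsub (I, α))
  have pv := int_pos hvpos jv hE0
  have pw := int_pos hpos jw hE0
  have lv : ∫ x in W.E I α, (w x)⁻¹ ≤ ∫ x in I.toSet, (w x)⁻¹ :=
    setIntegral_mono_set (I.integrableOn hlv) (Filter.Eventually.of_forall fun x => (hvpos x).le)
      (Filter.Eventually.of_forall (hEsub (I, α)))
  have lw : ∫ x in W.E I α, w x ≤ ∫ x in I.toSet, w x :=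
    setIntegral_mono_set (I.integrableOn hlw) (Filter.Eventually.of_forall fun x => (hpos x).le)
      (Filter.Eventually.of_forall (hEsub (I, α)))
  have hAI := hA (fun i => (I.m i : ℝ) * (2 : ℝ) ^ I.k) ((2 : ℝ) ^ I.k) (by positivity)
  rw [← I.eq_cube, avg, avg, ← measureReal_def] at hAI
  have hIE : volume.real I.toSet ≤ 2 ^ d * volume.real (W.E I α) := by
    have h1 := (f1 (I, α)).2.2
    have h2 := hEvol (I, α)
    have h3 := E1pos (I, α)
    simp only at h1 h2 h3
    rw [h2]
    refine h1.trans ?_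
    gcongr
    linarith
  have hI0 := hIpos I
  have phile : phi volume (fun x => (w x)⁻¹) w (W.E I α) ≤ 4 ^ d * A * volume.real (W.E I α) := by
    unfold phi entL
    set e := volume.real (W.E I α)
    set t := volume.real I.toSet
    set V := ∫ x in W.E I α, (w x)⁻¹
    set U := ∫ x in W.E I α, w x
    set V' := ∫ x in I.toSet, (w x)⁻¹
    set U' := ∫ x in I.toSet, w x
    rw [← mul_add, ← Real.log_mul (by positivity) (by positivity)]
    have l := Real.log_le_sub_one_of_pos (x := V / e * (U / e)) (by positivity)
    have b1 : ∀ a b : ℝ, 0 < a → a ≤ b → a / e ≤ 2 ^ d * (b / t) := by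
      intro a b ha hab
      rw [← mul_div_assoc, div_le_div_iff₀ hE0 hI0]
      calc a * t ≤ b * (2 ^ d * e) := mul_le_mul hab hIE hI0.le (ha.le.trans hab)
        _ = 2 ^ d * b * e := by ring
    have b2 : V / e * (U / e) ≤ 4 ^ d * A := by
      calc V / e * (U / e) ≤ (2 ^ d * (V' / t)) * (2 ^ d * (U' / t)) :=
            mul_le_mul (b1 _ _ pv lv) (b1 _ _ pw lw) (by positivity)
              (le_trans (by positivity) (b1 _ _ pv lv))
        _ = 4 ^ d * (U' / t * (V' / t)) := by
            rw [show (4 : ℝ) = 2 * 2 by norm_num, mul_pow]; ring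
        _ ≤ 4 ^ d * A := by gcongr
    calc e * Real.log (V / e * (U / e)) ≤ e * (4 ^ d * A) := by
          apply mul_le_mul_of_nonneg_left _ hE0.le; linarith
      _ = _ := by ring
  have hpn := phi_nonneg hvpos hpos (fun x => inv_mul_cancel₀ (hpos x).ne') jv jw
    (fin I _ (hEsub (I, α)))
  linarith
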